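/- The intuitionistic modal logic IK4, defined as the smallest super-FS logic containing the axioms □p → □□p and ◇◇p → ◇p, does not have the Craig interpolation property. -/

import Mathlib

/-- Formulas of the modal language L(□,◇). -/
inductive Fml : Type
  | var : ℕ → Fml
  | top : Fml
  | bot : Fml
  | and : Fml → Fml → Fml
  | or : Fml → Fml → Fml
  | imp : Fml → Fml → Fml
  | box : Fml → Fml
  | dia : Fml → Fml

/-- Uniform substitution. -/
def Fml.subst (σ : ℕ → Fml) : Fml → Fml
  | .var n => σ n
  | .top => .top
  | .bot => .bot
  | .and φ ψ => .and (φ.subst σ) (ψ.subst σ)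
  | .or φ ψ => .or (φ.subst σ) (ψ.subst σ)
  | .imp φ ψ => .imp (φ.subst σ) (ψ.subst σ)
  | .box φ => .box (φ.subst σ)
  | .dia φ => .dia (φ.subst σ)

/-- The set of propositional variables occurring in a formula. -/
def Fml.vars : Fml → Set ℕ
  | .var n => {n}
  | .top => ∅
  | .bot => ∅
  | .and φ ψ => φ.vars ∪ ψ.vars
  | .or φ ψ => φ.vars ∪ ψ.vars
  | .imp φ ψ => φ.vars ∪ ψ.vars
  | .box φ => φ.vars
  | .dia φ => φ.vars

/-- Theorems of the intuitionistic propositional calculus (in the modal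
language), given by a standard Hilbert-style axiomatization; the axiom
schemes range over all formulas, so the set is closed under substitution. -/
inductive IPC : Fml → Prop
  | ax1 (φ ψ : Fml) : IPC (φ.imp (ψ.imp φ))
  | ax2 (φ ψ χ : Fml) : IPC ((φ.imp (ψ.imp χ)).imp ((φ.imp ψ).imp (φ.imp χ)))
  | andE1 (φ ψ : Fml) : IPC ((φ.and ψ).imp φ)
  | andE2 (φ ψ : Fml) : IPC ((φ.and ψ).imp ψ)
  | andI (φ ψ : Fml) : IPC (φ.imp (ψ.imp (φ.and ψ)))
  | orI1 (φ ψ : Fml) : IPC (φ.imp (φ.or ψ))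
  | orI2 (φ ψ : Fml) : IPC (ψ.imp (φ.or ψ))
  | orE (φ ψ χ : Fml) : IPC ((φ.imp χ).imp ((ψ.imp χ).imp ((φ.or ψ).imp χ)))
  | botE (φ : Fml) : IPC (Fml.bot.imp φ)
  | topI : IPC Fml.top
  | mp (φ ψ : Fml) : IPC (φ.imp ψ) → IPC φ → IPC ψ

/-- A super-Fischer-Servi logic. -/
structure SuperFS (L : Set Fml) : Prop where
  ipc : ∀ φ : Fml, IPC φ → φ ∈ L
  axK : ∀ p q : Fml, ((p.imp q).box).imp ((p.box).imp (q.box)) ∈ L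
  axKdia : ∀ p q : Fml, ((p.imp q).box).imp ((p.dia).imp (q.dia)) ∈ L
  axDiaOr : ∀ p q : Fml, ((p.or q).dia).imp ((p.dia).or (q.dia)) ∈ L
  axFS : ∀ p q : Fml, (((p.dia).imp (q.box)).imp ((p.imp q).box)) ∈ L
  axDiaBot : (Fml.bot.dia).imp Fml.bot ∈ L
  subst : ∀ φ ∈ L, ∀ σ : ℕ → Fml, φ.subst σ ∈ L
  mp : ∀ φ ψ : Fml, φ.imp ψ ∈ L → φ ∈ L → ψ ∈ L
  nec : ∀ φ ∈ L, φ.box ∈ L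

/-- The Craig interpolation property. -/
def CIP (L : Set Fml) : Prop :=
  ∀ φ ψ : Fml, φ.imp ψ ∈ L →
    ∃ χ : Fml, χ.vars ⊆ φ.vars ∩ ψ.vars ∧ φ.imp χ ∈ L ∧ χ.imp ψ ∈ L


/-- The 4 axiom □p → □□p. -/
def axFour : Fml := ((Fml.var 0).box).imp ((Fml.var 0).box.box)

/-- The 4 axiom ◇◇p → ◇p. -/
def axFourDia : Fml := ((Fml.var 0).dia.dia).imp ((Fml.var 0).dia)

/-- IK4: the smallest super-FS logic containing □p → □□p and ◇◇p → ◇p. -/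
def IK4 : Set Fml := {φ | ∀ L : Set Fml, SuperFS L → axFour ∈ L → axFourDia ∈ L → φ ∈ L}

/-! ### Deductions inside a super-FS logic -/

/-- `T` contains the logic `L` and is closed under modus ponens. -/
structure IsTheory (L T : Set Fml) : Prop where
  sub : L ⊆ T
  mp : ∀ {φ ψ : Fml}, φ.imp ψ ∈ T → φ ∈ T → ψ ∈ T

theorem SuperFS.isTheory {L : Set Fml} (hL : SuperFS L) : IsTheory L L :=
  ⟨fun _ h => h, fun {φ ψ} => hL.mp φ ψ⟩

namespace IsTheory

variable {L T : Set Fml} {φ ψ χ : Fml}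

theorem ipc (hL : SuperFS L) (hT : IsTheory L T) (h : IPC φ) : φ ∈ T :=
  hT.sub (hL.ipc φ h)

/-- The deduction theorem. -/
theorem imp_mem (hL : SuperFS L) (hT : IsTheory L T)
    (h : ∀ T', IsTheory L T' → T ⊆ T' → φ ∈ T' → ψ ∈ T') : φ.imp ψ ∈ T := by
  have hsub : T ⊆ {χ | φ.imp χ ∈ T} := fun χ hχ => hT.mp (hT.ipc hL (.ax1 χ φ)) hχ
  refine h {χ | φ.imp χ ∈ T} ⟨hT.sub.trans hsub, ?_⟩ hsub ?_
  · exact fun {α β} hαβ hα => hT.mp (hT.mp (hT.ipc hL (.ax2 φ α β)) hαβ) hα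
  · exact hT.mp (hT.mp (hT.ipc hL (.ax2 φ (φ.imp φ) φ)) (hT.ipc hL (.ax1 φ (φ.imp φ))))
      (hT.ipc hL (.ax1 φ φ))

theorem and_left (hL : SuperFS L) (hT : IsTheory L T) (h : φ.and ψ ∈ T) : φ ∈ T :=
  hT.mp (hT.ipc hL (.andE1 φ ψ)) h

theorem and_right (hL : SuperFS L) (hT : IsTheory L T) (h : φ.and ψ ∈ T) : ψ ∈ T :=
  hT.mp (hT.ipc hL (.andE2 φ ψ)) h

theorem and_mem (hL : SuperFS L) (hT : IsTheory L T) (hφ : φ ∈ T) (hψ : ψ ∈ T) :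
    φ.and ψ ∈ T :=
  hT.mp (hT.mp (hT.ipc hL (.andI φ ψ)) hφ) hψ

theorem or_inl (hL : SuperFS L) (hT : IsTheory L T) (h : φ ∈ T) : φ.or ψ ∈ T :=
  hT.mp (hT.ipc hL (.orI1 φ ψ)) h

theorem or_inr (hL : SuperFS L) (hT : IsTheory L T) (h : ψ ∈ T) : φ.or ψ ∈ T :=
  hT.mp (hT.ipc hL (.orI2 φ ψ)) h

theorem or_elim (hL : SuperFS L) (hT : IsTheory L T) (h : φ.or ψ ∈ T)
    (hφ : ∀ T', IsTheory L T' → T ⊆ T' → φ ∈ T' → χ ∈ T')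
    (hψ : ∀ T', IsTheory L T' → T ⊆ T' → ψ ∈ T' → χ ∈ T') : χ ∈ T :=
  hT.mp (hT.mp (hT.mp (hT.ipc hL (.orE φ ψ χ)) (hT.imp_mem hL hφ)) (hT.imp_mem hL hψ)) h

theorem box_mp (hL : SuperFS L) (hT : IsTheory L T) (h : (φ.imp ψ).box ∈ T)
    (hφ : φ.box ∈ T) : ψ.box ∈ T :=
  hT.mp (hT.mp (hT.sub (hL.axK φ ψ)) h) hφ

theorem dia_mp (hL : SuperFS L) (hT : IsTheory L T) (h : (φ.imp ψ).box ∈ T)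
    (hφ : φ.dia ∈ T) : ψ.dia ∈ T :=
  hT.mp (hT.mp (hT.sub (hL.axKdia φ ψ)) h) hφ

theorem box_mono₂ (hL : SuperFS L) (hT : IsTheory L T) (hφ : φ.box ∈ T) (hψ : ψ.box ∈ T)
    (h : ∀ T', IsTheory L T' → φ ∈ T' → ψ ∈ T' → χ ∈ T') : χ.box ∈ T := by
  refine hT.box_mp hL (hT.box_mp hL (hT.sub (hL.nec (φ.imp (ψ.imp χ)) ?_)) hφ) hψ
  exact hL.isTheory.imp_mem hL fun _ h₁ _ m₁ =>
    h₁.imp_mem hL fun T₂ h₂ s₂ m₂ => h T₂ h₂ (s₂ m₁) m₂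

end IsTheory

/-! ### The implication without an interpolant

The variables `0`, `1`, `2` are shared; `3` occurs only in the antecedent and `4` only in the
consequent. -/

/-- `□(p ∨ s ∨ t) ∧ ◇⊤ ∧ (r → □(p → s))`. -/
def antecedent : Fml :=
  ((Fml.box (.or (.var 3) (.or (.var 1) (.var 2)))).and (Fml.dia .top)).and
    ((Fml.var 0).imp (Fml.box ((Fml.var 3).imp (.var 1))))

/-- `□(q ∨ s ∨ t) ∧ (r → □(q → t)) → ◇(s ∨ t) ∨ (r → ◇(s ∧ t))`. -/
def consequent : Fml :=
  ((Fml.box (.or (.var 4) (.or (.var 1) (.var 2)))).and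
    ((Fml.var 0).imp (Fml.box ((Fml.var 4).imp (.var 2))))).imp
    ((Fml.dia ((Fml.var 1).or (.var 2))).or
      ((Fml.var 0).imp (Fml.dia ((Fml.var 1).and (.var 2)))))

theorem antecedent_imp_consequent_mem {L : Set Fml} (hL : SuperFS L) :
    antecedent.imp consequent ∈ L := by
  refine hL.isTheory.imp_mem hL fun T₁ h₁ _ hA => h₁.imp_mem hL fun T hT s₁ hB => ?_
  replace hA := s₁ hA
  have hp := hT.and_left hL (hT.and_left hL hA)
  have hd := hT.and_right hL (hT.and_left hL hA)
  have hrp := hT.and_right hL hA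
  have hq := hT.and_left hL hB
  have hrq := hT.and_right hL hB
  have hbox : (Fml.top.imp (((Fml.var 1).or (.var 2)).or ((Fml.var 3).and (.var 4)))).box ∈ T :=
    hT.box_mono₂ hL hp hq fun _ h m n => h.imp_mem hL fun _ h' s' _ =>
      h'.or_elim hL (s' m)
        (fun _ h₂ s₂ m₂ => h₂.or_elim hL (s₂ (s' n))
          (fun _ h₃ s₃ m₃ => h₃.or_inr hL (h₃.and_mem hL (s₃ m₂) m₃))
          (fun _ h₃ _ m₃ => h₃.or_inl hL m₃))
        (fun _ h₂ _ m₂ => h₂.or_inl hL m₂)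
  refine hT.or_elim hL (hT.mp (hT.sub (hL.axDiaOr _ _)) (hT.dia_mp hL hbox hd))
    (fun _ h _ m => h.or_inl hL m) fun _ h s m => h.or_inr hL ?_
  refine h.imp_mem hL fun _ h' s' hr => h'.dia_mp hL ?_ (s' m)
  exact h'.box_mono₂ hL (h'.mp (s' (s hrp)) hr) (h'.mp (s' (s hrq)) hr) fun _ h₂ m₂ n₂ =>
    h₂.imp_mem hL fun _ h₃ s₃ m₃ => h₃.and_mem hL
      (h₃.mp (s₃ m₂) (h₃.and_left hL m₃)) (h₃.mp (s₃ n₂) (h₃.and_right hL m₃))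

/-! ### Birelational semantics -/

/-- A transitive birelational frame. -/
structure BiFrame (W : Type) where
  le : W → W → Prop
  R : W → W → Prop
  refl : ∀ x, le x x
  trans : ∀ x y z, le x y → le y z → le x z
  forth : ∀ x x' y, le x x' → R x y → ∃ y', le y y' ∧ R x' y'
  back : ∀ x y y', R x y → le y y' → ∃ x', le x x' ∧ R x' y'
  R_trans : ∀ x y z, R x y → R y z → R x z

namespace BiFrame

variable {W : Type} (F : BiFrame W)

def Forces (V : ℕ → W → Prop) : Fml → W → Prop
  | .var n, x => V n x
  | .top, _ => True
  | .bot, _ => False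
  | .and φ ψ, x => Forces V φ x ∧ Forces V ψ x
  | .or φ ψ, x => Forces V φ x ∨ Forces V ψ x
  | .imp φ ψ, x => ∀ y, F.le x y → Forces V φ y → Forces V ψ y
  | .box φ, x => ∀ y, F.le x y → ∀ z, F.R y z → Forces V φ z
  | .dia φ, x => ∃ y, F.R x y ∧ Forces V φ y

def Persistent (V : ℕ → W → Prop) : Prop :=
  ∀ n x y, F.le x y → V n x → V n y

variable {F} {V : ℕ → W → Prop}

theorem Forces.mono (hV : F.Persistent V) {φ : Fml} {x y : W} (hxy : F.le x y)
    (h : F.Forces V φ x) : F.Forces V φ y := by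
  induction φ generalizing x y with
  | var n => exact hV n x y hxy h
  | top => trivial
  | bot => exact h
  | and φ ψ ihφ ihψ => exact ⟨ihφ hxy h.1, ihψ hxy h.2⟩
  | or φ ψ ihφ ihψ => exact h.imp (ihφ hxy) (ihψ hxy)
  | imp φ ψ ihφ ihψ => exact fun z hz => h z (F.trans _ _ _ hxy hz)
  | box φ ih => exact fun z hz => h z (F.trans _ _ _ hxy hz)
  | dia φ ih =>
    obtain ⟨z, hz, hφ⟩ := h
    obtain ⟨z', hz', hR⟩ := F.forth _ _ _ hxy hz
    exact ⟨z', hR, ih hz' hφ⟩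

theorem forces_subst (σ : ℕ → Fml) (φ : Fml) (x : W) :
    F.Forces V (φ.subst σ) x ↔ F.Forces (fun n => F.Forces V (σ n)) φ x := by
  induction φ generalizing x with
  | var n => rfl
  | top => rfl
  | bot => rfl
  | and φ ψ ihφ ihψ => simp only [Fml.subst, Forces, ihφ, ihψ]
  | or φ ψ ihφ ihψ => simp only [Fml.subst, Forces, ihφ, ihψ]
  | imp φ ψ ihφ ihψ => simp only [Fml.subst, Forces, ihφ, ihψ]
  | box φ ih => simp only [Fml.subst, Forces, ih]
  | dia φ ih => simp only [Fml.subst, Forces, ih]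

theorem forces_of_IPC (hV : F.Persistent V) {φ : Fml} (h : IPC φ) (x : W) :
    F.Forces V φ x := by
  induction h generalizing x with
  | ax1 φ ψ => exact fun y _ h z hz _ => h.mono hV hz
  | ax2 φ ψ χ =>
    exact fun y _ h z hz h' u hu hφ =>
      h u (F.trans _ _ _ hz hu) hφ u (F.refl u) (h' u hu hφ)
  | andE1 φ ψ => exact fun y _ h => h.1
  | andE2 φ ψ => exact fun y _ h => h.2
  | andI φ ψ => exact fun y _ h z hz h' => ⟨h.mono hV hz, h'⟩
  | orI1 φ ψ => exact fun y _ h => Or.inl h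
  | orI2 φ ψ => exact fun y _ h => Or.inr h
  | orE φ ψ χ =>
    exact fun y _ h z hz h' u hu hor =>
      hor.elim (h u (F.trans _ _ _ hz hu)) (h' u hu)
  | botE φ => exact fun y _ h => h.elim
  | topI => trivial
  | mp φ ψ _ _ ih₁ ih₂ => exact ih₁ x x (F.refl x) (ih₂ x)

variable (F) in
/-- The logic of a frame. -/
def logic : Set Fml :=
  {φ | ∀ V, F.Persistent V → ∀ x, F.Forces V φ x}

theorem superFS_logic : SuperFS F.logic where
  ipc _ h _ hV := forces_of_IPC hV h
  axK _ _ _ _ _ _ _ h y hy h' z hz u hu :=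
    h z (F.trans _ _ _ hy hz) u hu u (F.refl u) (h' z hz u hu)
  axKdia _ _ _ _ _ _ _ h y hy := fun ⟨z, hz, h'⟩ => ⟨z, hz, h y hy z hz z (F.refl z) h'⟩
  axDiaOr _ _ _ _ _ _ _ := fun ⟨z, hz, h⟩ =>
    h.imp (fun h => ⟨z, hz, h⟩) (fun h => ⟨z, hz, h⟩)
  axFS _ _ _ _ _ _ _ h y hy z hz u hu hp := by
    obtain ⟨y', hy', hR⟩ := F.back _ _ _ hz hu
    exact h y' (F.trans _ _ _ hy hy') ⟨u, hR, hp⟩ y' (F.refl y') u hR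
  axDiaBot _ _ _ _ _ := fun ⟨_, _, h⟩ => h
  subst φ h σ V hV x :=
    (forces_subst σ φ x).2 (h (fun n => F.Forces V (σ n)) (fun _ _ _ hxy hx => Forces.mono hV hxy hx) x)
  mp _ _ h h' V hV x := h V hV x x (F.refl x) (h' V hV x)
  nec _ h V hV _ _ _ z _ := h V hV z

theorem axFour_mem_logic : axFour ∈ F.logic := by
  intro V hV x y _ h z hz u hu v hv w hw
  obtain ⟨z', hz', hR⟩ := F.back _ _ _ hu hv
  exact h z' (F.trans _ _ _ hz hz') w (F.R_trans _ _ _ hR hw)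

theorem axFourDia_mem_logic : axFourDia ∈ F.logic := by
  rintro V hV x y _ ⟨z, hz, u, hu, h⟩
  exact ⟨u, F.R_trans _ _ _ hz hu, h⟩

theorem IK4_subset_logic : IK4 ⊆ F.logic :=
  fun _ h => h _ superFS_logic axFour_mem_logic axFourDia_mem_logic

/-- `Z` is a symmetric bisimulation of the frame `F` with itself, linking the valuations `V`
and `V'` on the variables in `S`. -/
structure Bisim (F : BiFrame W) (S : Set ℕ) (V V' : ℕ → W → Prop) (Z : W → W → Prop) :
    Prop where
  symm : ∀ x y, Z x y → Z y x
  atom : ∀ x y, Z x y → ∀ n ∈ S, (V n x ↔ V' n y)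
  le : ∀ x y x', Z x y → F.le x x' → ∃ y', F.le y y' ∧ Z x' y'
  R : ∀ x y x', Z x y → F.R x x' → ∃ y', F.R y y' ∧ Z x' y'

theorem Bisim.forces_iff {S : Set ℕ} {V' : ℕ → W → Prop} {Z : W → W → Prop}
    (hZ : F.Bisim S V V' Z) {φ : Fml} (hφ : φ.vars ⊆ S) {x y : W} (hxy : Z x y) :
    F.Forces V φ x ↔ F.Forces V' φ y := by
  induction φ generalizing x y with
  | var n => exact hZ.atom x y hxy n (hφ rfl)
  | top => rfl
  | bot => rfl
  | and φ ψ ihφ ihψ =>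
    exact and_congr (ihφ (Set.union_subset_iff.1 hφ).1 hxy) (ihψ (Set.union_subset_iff.1 hφ).2 hxy)
  | or φ ψ ihφ ihψ =>
    exact or_congr (ihφ (Set.union_subset_iff.1 hφ).1 hxy) (ihψ (Set.union_subset_iff.1 hφ).2 hxy)
  | imp φ ψ ihφ ihψ =>
    obtain ⟨hφ, hψ⟩ := Set.union_subset_iff.1 hφ
    constructor
    · intro h y' hy hy'
      obtain ⟨x', hx, hz⟩ := hZ.le _ _ _ (hZ.symm _ _ hxy) hy
      have hz := hZ.symm _ _ hz
      exact (ihψ hψ hz).1 (h x' hx ((ihφ hφ hz).2 hy'))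
    · intro h x' hx hx'
      obtain ⟨y', hy, hz⟩ := hZ.le _ _ _ hxy hx
      exact (ihψ hψ hz).2 (h y' hy ((ihφ hφ hz).1 hx'))
  | box φ ih =>
    constructor
    · intro h y' hy v hv
      obtain ⟨x', hx, hz⟩ := hZ.le _ _ _ (hZ.symm _ _ hxy) hy
      obtain ⟨u, hu, hz⟩ := hZ.R _ _ _ hz hv
      exact (ih hφ (hZ.symm _ _ hz)).1 (h x' hx u hu)
    · intro h x' hx u hu
      obtain ⟨y', hy, hz⟩ := hZ.le _ _ _ hxy hx
      obtain ⟨v, hv, hz⟩ := hZ.R _ _ _ hz hu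
      exact (ih hφ hz).2 (h y' hy v hv)
  | dia φ ih =>
    constructor
    · rintro ⟨u, hu, h⟩
      obtain ⟨v, hv, hz⟩ := hZ.R _ _ _ hxy hu
      exact ⟨v, hv, (ih hφ hz).1 h⟩
    · rintro ⟨v, hv, h⟩
      obtain ⟨u, hu, hz⟩ := hZ.R _ _ _ (hZ.symm _ _ hxy) hv
      exact ⟨u, hu, (ih hφ (hZ.symm _ _ hz)).2 h⟩

end BiFrame

/-! ### Two bisimilar models separating the antecedent from the consequent -/

/-- The partial order on `Fin 7` generated by `0 < 1, 2` and `3 < 4, 5`. -/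
def separatingLe (x y : Fin 7) : Prop :=
  x = y ∨ (x = 0 ∧ (y = 1 ∨ y = 2)) ∨ (x = 3 ∧ (y = 4 ∨ y = 5))

/-- The relation in which `0` sees `3`, `1` sees `4, 6`, and `2` sees `4, 5`. -/
def separatingR (x y : Fin 7) : Prop :=
  (x = 0 ∧ y = 3) ∨ (x = 1 ∧ (y = 4 ∨ y = 6)) ∨ (x = 2 ∧ (y = 4 ∨ y = 5))

instance : DecidableRel separatingLe := fun x y => by unfold separatingLe; infer_instance

instance : DecidableRel separatingR := fun x y => by unfold separatingR; infer_instance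

def separatingFrame : BiFrame (Fin 7) where
  le := separatingLe
  R := separatingR
  refl := by decide
  trans := by decide
  forth := by decide
  back := by decide
  R_trans := by decide

def antecedentVal : ℕ → Fin 7 → Prop
  | 0, x => x = 1
  | 1, x => x = 4
  | 2, x => x = 5 ∨ x = 6
  | 3, x => x = 3 ∨ x = 4 ∨ x = 5
  | _, _ => False

def consequentVal : ℕ → Fin 7 → Prop
  | 0, x => x = 1
  | 1, x => x = 5 ∨ x = 6
  | 2, x => x = 4
  | 4, x => x = 3 ∨ x = 4 ∨ x = 5
  | _, _ => False

def separatingRel (x y : Fin 7) : Prop :=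
  (x = y ∧ x < 4) ∨ (x = 4 ∧ 4 < y) ∨ (4 < x ∧ y = 4)

instance : DecidableRel separatingRel := fun x y => by unfold separatingRel; infer_instance

theorem persistent_antecedentVal : separatingFrame.Persistent antecedentVal := by
  rintro (_ | _ | _ | _ | n) <;> simp only [antecedentVal, separatingFrame] <;> decide

theorem persistent_consequentVal : separatingFrame.Persistent consequentVal := by
  rintro (_ | _ | _ | _ | _ | n) <;> simp only [consequentVal, separatingFrame] <;> decide

theorem bisim_separatingRel :
    separatingFrame.Bisim {0, 1, 2} antecedentVal consequentVal separatingRel where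
  symm := by decide
  atom := by
    rintro x y h n (rfl | rfl | rfl) <;> revert x y <;>
      simp only [antecedentVal, consequentVal] <;> decide
  le := by simp only [separatingFrame]; decide
  R := by simp only [separatingFrame]; decide

theorem forces_antecedent : separatingFrame.Forces antecedentVal antecedent 0 := by
  simp only [antecedent, BiFrame.Forces, antecedentVal, separatingFrame]
  refine ⟨⟨by decide, by decide⟩, ?_⟩
  rintro y - rfl
  decide

theorem not_forces_consequent : ¬ separatingFrame.Forces consequentVal consequent 0 := by
  simp only [consequent, BiFrame.Forces, consequentVal, separatingFrame]
  intro h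
  refine absurd (h 0 (by decide) ⟨by decide, ?_⟩) (by decide)
  rintro y - rfl
  decide

theorem vars_antecedent_inter_consequent :
    antecedent.vars ∩ consequent.vars ⊆ {0, 1, 2} := by
  intro n
  simp only [antecedent, consequent, Fml.vars, Set.mem_inter_iff, Set.mem_union,
    Set.mem_singleton_iff, Set.mem_insert_iff, Set.mem_empty_iff_false]
  grind

/-- IK4 does not have the Craig interpolation property. -/
theorem IK4_no_CIP : ¬ CIP IK4 := by
  intro h
  obtain ⟨χ, hχ, h₁, h₂⟩ := h antecedent consequent
    fun _ hL _ _ => antecedent_imp_consequent_mem hL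
  have hx : separatingFrame.Forces antecedentVal χ 0 :=
    BiFrame.IK4_subset_logic h₁ _ persistent_antecedentVal 0 0 (separatingFrame.refl 0)
      forces_antecedent
  have hy : separatingFrame.Forces consequentVal χ 0 :=
    (bisim_separatingRel.forces_iff (hχ.trans vars_antecedent_inter_consequent)
      (Or.inl ⟨rfl, by decide⟩)).1 hx
  exact not_forces_consequent
    (BiFrame.IK4_subset_logic h₂ _ persistent_consequentVal 0 0 (separatingFrame.refl 0) hy)
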